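/- arXiv:1607.01579 — 3 statements merged into one kernel-verified Lean document; each statement's English description precedes it below -/
import Mathlib

section
/- Let M be the block matrix M = [[A, C], [B, D]] with A ∈ ℂ^{p×q}, B ∈ ℂ^{r×q}, C ∈ ℂ^{p×s}, D ∈ ℂ^{r×s}, and let S_A = D − BA†C be the generalized Schur complement of A in M. If R(B*) ⊆ R(A*) and R(C) ⊆ R(A), then M† = [[Σ, ΣH*E_{S_A} − ΨKS_A†], [F_{S_A}K*Σ − S_A†HΦ, S_A† − S_A†HΦH*E_{S_A} − F_{S_A}K*ΨKS_A† + F_{S_A}K*ΣH*E_{S_A}]], where H = BA†, K = A†C, Φ = (I + H*E_{S_A}H)^{-1}, Ψ = (I + KF_{S_A}K*)^{-1}, and Σ = Ψ(A† + KS_A†H)Φ. -/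
open Matrix

/-- `Z` is the Moore–Penrose inverse of `A`. -/
def IsMP {m n : Type*} [Fintype m] [Fintype n]
    (A : Matrix m n ℂ) (Z : Matrix n m ℂ) : Prop :=
  A * Z * A = A ∧ Z * A * Z = Z ∧ (A * Z)ᴴ = A * Z ∧ (Z * A)ᴴ = Z * A

section MoorePenrose

open scoped ComplexOrder

universe u

variable {l m n k : Type u} [Fintype l] [Fintype m] [Fintype n] [Fintype k]

theorem IsMP.unique {A : Matrix m n ℂ} {Y Z : Matrix n m ℂ} (hY : IsMP A Y) (hZ : IsMP A Z) :
    Y = Z := by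
  obtain ⟨y1, y2, y3, y4⟩ := hY
  obtain ⟨z1, z2, z3, z4⟩ := hZ
  have hl : A * Y = A * Z := by
    calc A * Y = (A * Y)ᴴ := y3.symm
      _ = ((A * Z) * (A * Y))ᴴ := by rw [← Matrix.mul_assoc, z1]
      _ = (A * Y) * (A * Z) := by rw [conjTranspose_mul, y3, z3]
      _ = A * Z := by rw [← Matrix.mul_assoc, y1]
  have hr : Y * A = Z * A := by
    calc Y * A = (Y * A)ᴴ := y4.symm
      _ = ((Y * A) * (Z * A))ᴴ := by rw [Matrix.mul_assoc, ← Matrix.mul_assoc A, z1]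
      _ = (Z * A) * (Y * A) := by rw [conjTranspose_mul, y4, z4]
      _ = Z * A := by rw [Matrix.mul_assoc, ← Matrix.mul_assoc A, y1]
  rw [← y2, hr, Matrix.mul_assoc, hl, ← Matrix.mul_assoc, z2]

theorem IsMP.conjTranspose {A : Matrix m n ℂ} {Z : Matrix n m ℂ} (h : IsMP A Z) :
    IsMP Aᴴ Zᴴ := by
  obtain ⟨h1, h2, h3, h4⟩ := h
  refine ⟨?_, ?_, ?_, ?_⟩
  · rw [← conjTranspose_mul, ← conjTranspose_mul, ← Matrix.mul_assoc, h1]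
  · rw [← conjTranspose_mul, ← conjTranspose_mul, ← Matrix.mul_assoc, h2]
  · rw [← conjTranspose_mul, h4, h4]
  · rw [← conjTranspose_mul, h3, h3]

theorem IsMP.mul_mul_eq_of_range_le {A : Matrix m n ℂ} {Z : Matrix n m ℂ} (h : IsMP A Z)
    {C : Matrix m k ℂ} (hC : LinearMap.range C.mulVecLin ≤ LinearMap.range A.mulVecLin) :
    A * (Z * C) = C := by
  classical
  refine ext_of_mulVec_single fun i => ?_
  obtain ⟨u, hu⟩ := hC ⟨Pi.single i 1, rfl⟩
  simp only [mulVecLin_apply] at hu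
  rw [← Matrix.mul_assoc, ← mulVec_mulVec, ← hu, mulVec_mulVec, h.1]

/-- An orthogonal projection `E` makes `1 + Hᴴ * E * H` invertible. -/
theorem isUnit_det_one_add_conjTranspose_mul_mul [DecidableEq n] {E : Matrix m m ℂ}
    (hE : Eᴴ = E) (hEE : E * E = E) (H : Matrix m n ℂ) : IsUnit (1 + Hᴴ * E * H).det := by
  have h : Hᴴ * E * H = (E * H)ᴴ * (E * H) := by
    rw [conjTranspose_mul, hE, Matrix.mul_assoc Hᴴ E (E * H), ← Matrix.mul_assoc E E, hEE,
      Matrix.mul_assoc]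
  rw [h, ← isUnit_iff_isUnit_det]
  exact (PosDef.one.add_posSemidef (posSemidef_conjTranspose_mul_self (E * H))).isUnit

/-- The candidate for the Moore–Penrose inverse of a block matrix, in terms of the inverse `Z` of
the leading block, the inverse `T` of the Schur complement, and the auxiliary matrices. -/
def blockMP (Z : Matrix n m ℂ) (T : Matrix k l ℂ) (H : Matrix l m ℂ) (K : Matrix n k ℂ)
    (E : Matrix l l ℂ) (F : Matrix k k ℂ) (Φ : Matrix m m ℂ) (Ψ : Matrix n n ℂ) :
    Matrix (n ⊕ k) (m ⊕ l) ℂ :=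
  fromBlocks
    (Ψ * (Z + K * T * H) * Φ)
    (Ψ * (Z + K * T * H) * Φ * Hᴴ * E - Ψ * K * T)
    (F * Kᴴ * (Ψ * (Z + K * T * H) * Φ) - T * H * Φ)
    (T - T * H * Φ * Hᴴ * E - F * Kᴴ * Ψ * K * T + F * Kᴴ * (Ψ * (Z + K * T * H) * Φ) * Hᴴ * E)

theorem conjTranspose_blockMP (Z : Matrix n m ℂ) (T : Matrix k l ℂ) (H : Matrix l m ℂ)
    (K : Matrix n k ℂ) {E : Matrix l l ℂ} {F : Matrix k k ℂ} {Φ : Matrix m m ℂ} {Ψ : Matrix n n ℂ}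
    (hE : Eᴴ = E) (hF : Fᴴ = F) (hΦ : Φᴴ = Φ) (hΨ : Ψᴴ = Ψ) :
    (blockMP Z T H K E F Φ Ψ)ᴴ = blockMP Zᴴ Tᴴ Kᴴ Hᴴ F E Ψ Φ := by
  simp only [blockMP, fromBlocks_conjTranspose, conjTranspose_add, conjTranspose_sub,
    conjTranspose_mul, conjTranspose_conjTranspose, hE, hF, hΦ, hΨ, Matrix.mul_assoc]
  congr 1
  abel

theorem fromBlocks_mul_blockMP [DecidableEq l] [DecidableEq n] {A : Matrix m n ℂ}
    {Z : Matrix n m ℂ} {S : Matrix l k ℂ}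
    {T : Matrix k l ℂ} {H : Matrix l m ℂ} {K : Matrix n k ℂ} {E : Matrix l l ℂ}
    {F : Matrix k k ℂ} {Φ : Matrix m m ℂ} {Ψ : Matrix n n ℂ}
    (hE : E = 1 - S * T) (hSF : S * F = 0) (hHZ : H * (A * Z) = H)
    (hΦH : A * (Z * (Φ * Hᴴ)) = Φ * Hᴴ) (hΨ : (1 + K * F * Kᴴ) * Ψ = 1) :
    fromBlocks A (A * K) (H * A) (S + H * (A * K)) * blockMP Z T H K E F Φ Ψ =
      fromBlocks (A * Z * Φ) (Φ * Hᴴ * E) (E * H * Φ) (S * T + E * H * Φ * Hᴴ * E) := by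
  have eSF {t : Type u} (X : Matrix k t ℂ) : S * (F * X) = 0 := by
    rw [← Matrix.mul_assoc, hSF, Matrix.zero_mul]
  have eHZ {t : Type u} (X : Matrix m t ℂ) : H * (A * (Z * X)) = H * X := by
    rw [← Matrix.mul_assoc A, ← Matrix.mul_assoc, hHZ]
  have eΦH {t : Type u} (X : Matrix l t ℂ) : A * (Z * (Φ * (Hᴴ * X))) = Φ * (Hᴴ * X) := by
    rw [← Matrix.mul_assoc Φ, ← Matrix.mul_assoc Z, ← Matrix.mul_assoc A, hΦH]
  have eΨ {t : Type u} (X : Matrix n t ℂ) : K * (F * (Kᴴ * (Ψ * X))) = X - Ψ * X := by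
    rw [eq_sub_iff_add_eq']
    simpa only [Matrix.add_mul, Matrix.one_mul, Matrix.mul_assoc] using congrArg (· * X) hΨ
  have eE {t : Type u} (X : Matrix l t ℂ) : E * X = X - S * (T * X) := by
    rw [hE, Matrix.sub_mul, Matrix.one_mul, Matrix.mul_assoc]
  rw [blockMP, fromBlocks_multiply]
  congr 1
  · simp only [Matrix.mul_assoc, Matrix.mul_add, Matrix.add_mul, Matrix.mul_sub, eΨ]
    abel
  · simp only [Matrix.mul_assoc, Matrix.mul_add, Matrix.add_mul, Matrix.mul_sub, eΨ, eΦH]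
    abel
  · simp only [Matrix.mul_assoc, Matrix.mul_add, Matrix.add_mul, Matrix.mul_sub, Matrix.sub_mul, eΨ, eHZ,
      eSF, eE]
    abel
  · rw [Matrix.mul_assoc (E * H * Φ), Matrix.mul_assoc (E * H), Matrix.mul_assoc E, eE]
    simp only [Matrix.mul_assoc, Matrix.mul_add, Matrix.add_mul, Matrix.mul_sub, eΨ, eHZ, eSF]
    abel

/-- `Φ = (1 + Hᴴ * E * H)⁻¹` commutes with any `P` fixing `H` on the right and `Hᴴ` on the left. -/
theorem commute_of_mul_eq_one [DecidableEq m] {P Φ : Matrix m m ℂ} {E : Matrix l l ℂ}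
    {H : Matrix l m ℂ} (hHP : H * P = H) (hPH : P * Hᴴ = Hᴴ) (hl : Φ * (1 + Hᴴ * E * H) = 1)
    (hr : (1 + Hᴴ * E * H) * Φ = 1) : P * Φ = Φ * P := by
  have h : P * (1 + Hᴴ * E * H) = (1 + Hᴴ * E * H) * P := by
    rw [Matrix.mul_add, Matrix.add_mul, Matrix.mul_assoc _ H P, hHP, ← Matrix.mul_assoc P,
      ← Matrix.mul_assoc P, hPH, Matrix.mul_one, Matrix.one_mul]
  calc P * Φ = Φ * (1 + Hᴴ * E * H) * P * Φ := by rw [hl, Matrix.one_mul]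
    _ = Φ * (P * (1 + Hᴴ * E * H)) * Φ := by rw [h, Matrix.mul_assoc Φ]
    _ = Φ * P := by
      rw [Matrix.mul_assoc, Matrix.mul_assoc, hr, Matrix.mul_one]

set_option maxHeartbeats 1000000 in
theorem fromBlocks_blockMP_equations [DecidableEq l] [DecidableEq m] [DecidableEq n]
    [DecidableEq k] {A : Matrix m n ℂ} {Z : Matrix n m ℂ} {S : Matrix l k ℂ}
    {T : Matrix k l ℂ} {H : Matrix l m ℂ} {K : Matrix n k ℂ} {E : Matrix l l ℂ}
    {F : Matrix k k ℂ} {Φ : Matrix m m ℂ} {Ψ : Matrix n n ℂ} (hZ : IsMP A Z) (hT : IsMP S T)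
    (hE : E = 1 - S * T) (hF : F = 1 - T * S) (hHZ : H * (A * Z) = H)
    (hΦ' : Φᴴ = Φ) (hΦl : Φ * (1 + Hᴴ * E * H) = 1) (hΦr : (1 + Hᴴ * E * H) * Φ = 1)
    (hΨ : (1 + K * F * Kᴴ) * Ψ = 1) :
    let M := fromBlocks A (A * K) (H * A) (S + H * (A * K))
    let X := blockMP Z T H K E F Φ Ψ
    M * X * M = M ∧ X * (M * X) = X ∧ (M * X)ᴴ = M * X := by
  obtain ⟨hZ1, hZ2, hZ3, -⟩ := hZ
  obtain ⟨hT1, hT2, hT3, -⟩ := hT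
  have hEh : Eᴴ = E := by rw [hE, conjTranspose_sub, conjTranspose_one, hT3]
  have hSF : S * F = 0 := by
    rw [hF, Matrix.mul_sub, Matrix.mul_one, ← Matrix.mul_assoc, hT1, sub_self]
  have hES : E * S = 0 := by rw [hE, Matrix.sub_mul, Matrix.one_mul, hT1, sub_self]
  have hTE : T * E = 0 := by
    rw [hE, Matrix.mul_sub, Matrix.mul_one, ← Matrix.mul_assoc, hT2, sub_self]
  have hZH : A * Z * Hᴴ = Hᴴ := by
    simpa only [conjTranspose_mul, hZ3, ← conjTranspose_mul A Z] using congrArg (·ᴴ) hHZ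
  have hc : A * Z * Φ = Φ * (A * Z) := commute_of_mul_eq_one hHZ hZH hΦl hΦr
  have hΦH : A * (Z * (Φ * Hᴴ)) = Φ * Hᴴ := by
    rw [← Matrix.mul_assoc Z, ← Matrix.mul_assoc A, ← Matrix.mul_assoc A, hc, Matrix.mul_assoc, hZH]
  have hΦA : A * (Z * (Φ * A)) = Φ * A := by
    rw [← Matrix.mul_assoc Z, ← Matrix.mul_assoc A, ← Matrix.mul_assoc A, hc, Matrix.mul_assoc, hZ1]
  intro M X
  have hMX : M * X = _ := fromBlocks_mul_blockMP hE hSF hHZ hΦH hΨ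
  have eΦl {t : Type u} (Y : Matrix m t ℂ) : Φ * (Hᴴ * (E * (H * Y))) = Y - Φ * Y := by
    rw [eq_sub_iff_add_eq']
    simpa only [Matrix.mul_add, Matrix.add_mul, Matrix.mul_one, Matrix.mul_assoc, Matrix.one_mul]
      using congrArg (· * Y) hΦl
  have eΦr {t : Type u} (Y : Matrix m t ℂ) : Hᴴ * (E * (H * (Φ * Y))) = Y - Φ * Y := by
    rw [eq_sub_iff_add_eq']
    simpa only [Matrix.mul_add, Matrix.add_mul, Matrix.mul_one, Matrix.mul_assoc, Matrix.one_mul]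
      using congrArg (· * Y) hΦr
  have eΦr' : Hᴴ * (E * (H * Φ)) = 1 - Φ := by
    simpa only [Matrix.mul_one] using eΦr (1 : Matrix m m ℂ)
  have eΦA {t : Type u} (Y : Matrix n t ℂ) : A * (Z * (Φ * (A * Y))) = Φ * (A * Y) := by
    rw [← Matrix.mul_assoc Φ, ← Matrix.mul_assoc Z, ← Matrix.mul_assoc A, hΦA]
  have eHZ {t : Type u} (Y : Matrix m t ℂ) : H * (A * (Z * Y)) = H * Y := by
    rw [← Matrix.mul_assoc A, ← Matrix.mul_assoc, hHZ]
  have eZ {t : Type u} (Y : Matrix m t ℂ) : Z * (A * (Z * Y)) = Z * Y := by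
    rw [← Matrix.mul_assoc A, ← Matrix.mul_assoc, ← Matrix.mul_assoc, hZ2]
  have ec {t : Type u} (Y : Matrix m t ℂ) : Φ * (A * (Z * Y)) = A * (Z * (Φ * Y)) := by
    simpa only [Matrix.mul_assoc] using congrArg (· * Y) hc.symm
  have eTE {t : Type u} (Y : Matrix l t ℂ) : T * (E * Y) = 0 := by
    rw [← Matrix.mul_assoc, hTE, Matrix.zero_mul]
  have eES {t : Type u} (Y : Matrix k t ℂ) : E * (S * Y) = 0 := by
    rw [← Matrix.mul_assoc, hES, Matrix.zero_mul]
  have eT : T * (S * T) = T := by rw [← Matrix.mul_assoc, hT2]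
  have eS : S * (T * S) = S := by rw [← Matrix.mul_assoc, hT1]
  have eE {t : Type u} (Y : Matrix l t ℂ) : E * Y = Y - S * (T * Y) := by
    rw [hE, Matrix.sub_mul, Matrix.one_mul, Matrix.mul_assoc]
  have eEE {t : Type u} (Y : Matrix l t ℂ) : E * (E * Y) = E * Y := by
    rw [eE (E * Y), eTE, Matrix.mul_zero, sub_zero]
  rw [hMX]
  refine ⟨?_, ?_, ?_⟩
  · simp only [M]
    rw [fromBlocks_multiply]
    congr 1 <;>
    · simp only [Matrix.mul_assoc, Matrix.mul_add, Matrix.add_mul, Matrix.mul_sub, eΦl, eΦA, hΦA,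
        hES, eS, Matrix.mul_zero]
      try simp only [eE]
      abel
  · simp only [X, blockMP]
    rw [fromBlocks_multiply]
    congr 1 <;>
    · simp only [Matrix.mul_assoc, Matrix.mul_add, Matrix.add_mul, Matrix.mul_sub, Matrix.sub_mul,
        ec, eHZ, eZ, eΦr, eΦr', eTE, eES, eEE, eT, Matrix.mul_zero, Matrix.mul_one]
      abel
  · have hAZΦ : (A * Z * Φ)ᴴ = A * Z * Φ := by rw [conjTranspose_mul, hΦ', hZ3, hc]
    rw [fromBlocks_conjTranspose, conjTranspose_add, hAZΦ, hT3]
    simp only [conjTranspose_mul, conjTranspose_conjTranspose, hEh, hΦ', Matrix.mul_assoc]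

theorem isMP_fromBlocks_blockMP [DecidableEq l] [DecidableEq m] [DecidableEq n]
    [DecidableEq k] {A : Matrix m n ℂ} {Z : Matrix n m ℂ} {S : Matrix l k ℂ}
    {T : Matrix k l ℂ} {H : Matrix l m ℂ} {K : Matrix n k ℂ} (hZ : IsMP A Z) (hT : IsMP S T)
    (hHZ : H * (A * Z) = H) (hZK : Z * (A * K) = K) :
    IsMP (fromBlocks A (A * K) (H * A) (S + H * (A * K)))
      (blockMP Z T H K (1 - S * T) (1 - T * S) (1 + Hᴴ * (1 - S * T) * H)⁻¹
        (1 + K * (1 - T * S) * Kᴴ)⁻¹) := by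
  have hEh : (1 - S * T)ᴴ = 1 - S * T := by
    rw [conjTranspose_sub, conjTranspose_one, hT.2.2.1]
  have hFh : (1 - T * S)ᴴ = 1 - T * S := by
    rw [conjTranspose_sub, conjTranspose_one, hT.2.2.2]
  have hEE : (1 - S * T) * (1 - S * T) = 1 - S * T := by
    rw [Matrix.mul_sub, Matrix.mul_one, Matrix.sub_mul, Matrix.one_mul, ← Matrix.mul_assoc, hT.1,
      sub_self, sub_zero]
  have hFF : (1 - T * S) * (1 - T * S) = 1 - T * S := by
    rw [Matrix.mul_sub, Matrix.mul_one, Matrix.sub_mul, Matrix.one_mul, ← Matrix.mul_assoc,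
      hT.2.1, sub_self, sub_zero]
  have hF' : 1 - T * S = 1 - Sᴴ * Tᴴ := by rw [← conjTranspose_mul, hT.2.2.2]
  have hE' : 1 - S * T = 1 - Tᴴ * Sᴴ := by rw [← conjTranspose_mul, hT.2.2.1]
  have hΦ := isUnit_det_one_add_conjTranspose_mul_mul hEh hEE H
  have hΨ := isUnit_det_one_add_conjTranspose_mul_mul hFh hFF Kᴴ
  rw [conjTranspose_conjTranspose] at hΨ
  have hΦh : ((1 + Hᴴ * (1 - S * T) * H)⁻¹)ᴴ = (1 + Hᴴ * (1 - S * T) * H)⁻¹ := by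
    rw [conjTranspose_nonsing_inv, conjTranspose_add, conjTranspose_one, conjTranspose_mul,
      conjTranspose_mul, hEh, conjTranspose_conjTranspose, Matrix.mul_assoc]
  have hΨh : ((1 + K * (1 - T * S) * Kᴴ)⁻¹)ᴴ = (1 + K * (1 - T * S) * Kᴴ)⁻¹ := by
    rw [conjTranspose_nonsing_inv, conjTranspose_add, conjTranspose_one, conjTranspose_mul,
      conjTranspose_mul, hFh, conjTranspose_conjTranspose, Matrix.mul_assoc]
  have hKZ' : Kᴴ * (Aᴴ * Zᴴ) = Kᴴ := by
    rw [← conjTranspose_mul, ← conjTranspose_mul, Matrix.mul_assoc, hZK]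
  obtain ⟨h1, h2, h3⟩ := fromBlocks_blockMP_equations hZ hT rfl rfl hHZ hΦh
    (nonsing_inv_mul _ hΦ) (mul_nonsing_inv _ hΦ) (mul_nonsing_inv _ hΨ)
  obtain ⟨-, -, h4⟩ := fromBlocks_blockMP_equations (K := Hᴴ) hZ.conjTranspose hT.conjTranspose
    hF' hE' hKZ' hΨh
    (by rw [conjTranspose_conjTranspose]; exact nonsing_inv_mul _ hΨ)
    (by rw [conjTranspose_conjTranspose]; exact mul_nonsing_inv _ hΨ)
    (by rw [conjTranspose_conjTranspose]; exact mul_nonsing_inv _ hΦ)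
  have hM : fromBlocks Aᴴ (Aᴴ * Hᴴ) (Kᴴ * Aᴴ) (Sᴴ + Kᴴ * (Aᴴ * Hᴴ)) =
      (fromBlocks A (A * K) (H * A) (S + H * (A * K)))ᴴ := by
    simp only [fromBlocks_conjTranspose, conjTranspose_add, conjTranspose_mul, Matrix.mul_assoc]
  rw [hM, ← conjTranspose_blockMP Z T H K hEh hFh hΦh hΨh, ← conjTranspose_mul,
    conjTranspose_conjTranspose] at h4
  exact ⟨h1, by rw [Matrix.mul_assoc]; exact h2, h3, h4.symm⟩

end MoorePenrose

theorem stmt_1 {p q r s : ℕ}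
    (A : Matrix (Fin p) (Fin q) ℂ) (B : Matrix (Fin r) (Fin q) ℂ)
    (C : Matrix (Fin p) (Fin s) ℂ) (D : Matrix (Fin r) (Fin s) ℂ)
    (M : Matrix (Fin p ⊕ Fin r) (Fin q ⊕ Fin s) ℂ) (hM : M = Matrix.fromBlocks A C B D)
    (Adag : Matrix (Fin q) (Fin p) ℂ) (hAdag : IsMP A Adag)
    (S : Matrix (Fin r) (Fin s) ℂ) (hS : S = D - B * Adag * C)
    (Sdag : Matrix (Fin s) (Fin r) ℂ) (hSdag : IsMP S Sdag)
    (hB : LinearMap.range Bᴴ.mulVecLin ≤ LinearMap.range Aᴴ.mulVecLin)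
    (hC : LinearMap.range C.mulVecLin ≤ LinearMap.range A.mulVecLin)
    (Mdag : Matrix (Fin q ⊕ Fin s) (Fin p ⊕ Fin r) ℂ) (hMdag : IsMP M Mdag)
    (H : Matrix (Fin r) (Fin p) ℂ) (hH : H = B * Adag)
    (K : Matrix (Fin q) (Fin s) ℂ) (hK : K = Adag * C)
    (ES : Matrix (Fin r) (Fin r) ℂ) (hES : ES = 1 - S * Sdag)
    (FS : Matrix (Fin s) (Fin s) ℂ) (hFS : FS = 1 - Sdag * S)
    (Φ : Matrix (Fin p) (Fin p) ℂ) (hΦ : Φ = (1 + Hᴴ * ES * H)⁻¹)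
    (Ψ : Matrix (Fin q) (Fin q) ℂ) (hΨ : Ψ = (1 + K * FS * Kᴴ)⁻¹)
    (Sig : Matrix (Fin q) (Fin p) ℂ) (hSig : Sig = Ψ * (Adag + K * Sdag * H) * Φ) :
    Mdag = Matrix.fromBlocks
      Sig
      (Sig * Hᴴ * ES - Ψ * K * Sdag)
      (FS * Kᴴ * Sig - Sdag * H * Φ)
      (Sdag - Sdag * H * Φ * Hᴴ * ES - FS * Kᴴ * Ψ * K * Sdag + FS * Kᴴ * Sig * Hᴴ * ES) := by
  subst hES hFS hΦ hΨ hSig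
  have hAK : A * (Adag * C) = C := hAdag.mul_mul_eq_of_range_le hC
  have hHA : H * A = B := by
    have h := congrArg (·ᴴ) (hAdag.conjTranspose.mul_mul_eq_of_range_le hB)
    simpa only [conjTranspose_mul, conjTranspose_conjTranspose, hH] using h
  have hHZ : H * (A * Adag) = H := by rw [← Matrix.mul_assoc, hHA, hH]
  have hAK' : A * K = C := by rw [hK, hAK]
  have hZK : Adag * (A * K) = K := by rw [hAK', hK]
  have hD : S + H * C = D := by rw [hS, hH, sub_add_cancel]
  have h := isMP_fromBlocks_blockMP hAdag hSdag hHZ hZK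
  rw [hAK', hHA, hD, ← hM] at h
  rw [hMdag.unique h, blockMP]
end

section
/- Let A ∈ ℂ^{m×n}, U ∈ ℂ^{m×r}, V ∈ ℂ^{n×r}, and S_A = I + V*A†U. If R(V) ⊆ R(A*), then (I + (A†)* V E_{S_A} V*A†)(A + UV*) = A + UV*, and consequently (I + (A†)* V E_{S_A} V*A†)^{-1}(A + UV*) = A + UV*. -/
open Matrix

theorem Matrix.exists_eq_mul_of_range_mulVecLin_le {R l m n : Type*} [CommSemiring R]
    [Fintype m] [Fintype n] [DecidableEq m] {B : Matrix l m R} {C : Matrix l n R}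
    (h : LinearMap.range B.mulVecLin ≤ LinearMap.range C.mulVecLin) :
    ∃ W : Matrix n m R, B = C * W := by
  choose w hw using fun j => h (LinearMap.mem_range_self B.mulVecLin (Pi.single j 1))
  refine ⟨Matrix.of fun i j => w j i, ?_⟩
  ext i j
  have hij := congrFun (hw j) i
  simp only [mulVecLin_apply, mulVec_single_one, col_apply] at hij
  rw [← hij]
  rfl

open scoped ComplexOrder in
theorem IsMP.posSemidef_one_sub_mul {m n : Type*} [Fintype m] [Fintype n] [DecidableEq m]
    {A : Matrix m n ℂ} {Z : Matrix n m ℂ} (h : IsMP A Z) : (1 - A * Z).PosSemidef := by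
  have hE : (1 - A * Z)ᴴ * (1 - A * Z) = 1 - A * Z := by
    rw [conjTranspose_sub, conjTranspose_one, h.2.2.1, sub_mul, one_mul, mul_sub, mul_one,
      ← Matrix.mul_assoc, h.1, sub_self, sub_zero]
  rw [← hE]
  exact posSemidef_conjTranspose_mul_self _

open scoped ComplexOrder in
theorem Matrix.PosSemidef.isUnit_one_add_conjTranspose_mul_mul {m n : Type*} [Fintype m]
    [Fintype n] [DecidableEq n] {E : Matrix m m ℂ} (hE : E.PosSemidef) (B : Matrix m n ℂ) :
    IsUnit (1 + Bᴴ * E * B) :=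
  (PosDef.one.add_posSemidef (hE.conjTranspose_mul_mul_same B)).isUnit

theorem stmt_10 {m n r : ℕ}
    (A : Matrix (Fin m) (Fin n) ℂ) (U : Matrix (Fin m) (Fin r) ℂ)
    (V : Matrix (Fin n) (Fin r) ℂ)
    (Adag : Matrix (Fin n) (Fin m) ℂ) (hAdag : IsMP A Adag)
    (S : Matrix (Fin r) (Fin r) ℂ) (hS : S = 1 + Vᴴ * Adag * U)
    (Sdag : Matrix (Fin r) (Fin r) ℂ) (hSdag : IsMP S Sdag)
    (hV : LinearMap.range V.mulVecLin ≤ LinearMap.range Aᴴ.mulVecLin) :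
    (1 + Adagᴴ * V * (1 - S * Sdag) * Vᴴ * Adag) * (A + U * Vᴴ) = A + U * Vᴴ ∧
      (1 + Adagᴴ * V * (1 - S * Sdag) * Vᴴ * Adag)⁻¹ * (A + U * Vᴴ) = A + U * Vᴴ := by
  have hVA : Vᴴ * Adag * A = Vᴴ := by
    obtain ⟨W, rfl⟩ := exists_eq_mul_of_range_mulVecLin_le hV
    rw [conjTranspose_mul, conjTranspose_conjTranspose, Matrix.mul_assoc, Matrix.mul_assoc,
      ← Matrix.mul_assoc A, hAdag.1]
  have hSV : Vᴴ * Adag * (A + U * Vᴴ) = S * Vᴴ := by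
    rw [Matrix.mul_add, hVA, ← Matrix.mul_assoc, hS, Matrix.add_mul, Matrix.one_mul]
  have hES : (1 - S * Sdag) * S = 0 := by
    rw [sub_mul, one_mul, hSdag.1, sub_self]
  have hfix : (1 + Adagᴴ * V * (1 - S * Sdag) * Vᴴ * Adag) * (A + U * Vᴴ) = A + U * Vᴴ := by
    rw [Matrix.add_mul, Matrix.one_mul, Matrix.mul_assoc _ Vᴴ, Matrix.mul_assoc _ (Vᴴ * Adag),
      hSV, ← Matrix.mul_assoc, Matrix.mul_assoc _ _ S, hES, Matrix.mul_zero, Matrix.zero_mul,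
      add_zero]
  have hunit : IsUnit (1 + Adagᴴ * V * (1 - S * Sdag) * Vᴴ * Adag) := by
    simpa only [conjTranspose_mul, conjTranspose_conjTranspose, Matrix.mul_assoc] using
      hSdag.posSemidef_one_sub_mul.isUnit_one_add_conjTranspose_mul_mul (Vᴴ * Adag)
  refine ⟨hfix, ?_⟩
  conv_lhs => rw [← hfix]
  exact nonsing_inv_mul_cancel_left _ _ ((isUnit_iff_isUnit_det _).mp hunit)
end

section
/- Let A ∈ ℂ^{m×n}, U ∈ ℂ^{m×r}, V ∈ ℂ^{n×r}, and S_A = I + V*A†U. Assume R(U) ⊆ R(A) and R(V) ⊆ R(A*), and let Â = (I + A†U F_{S_A} U*(A†)*)^{-1} (A† − A†U S_A† V*A†) (I + (A†)* V E_{S_A} V*A†)^{-1}. Then Â (A + UV*) is Hermitian if and only if A†U F_{S_A} V* is Hermitian. -/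
open Matrix

/-- If `A * Z * A = A`, then `A * Z` fixes matrices whose columns lie in the range of `A`. -/
lemma mul_mul_eq_of_range_le {m n r : Type*} [Fintype m] [Fintype n] [Fintype r]
    {A : Matrix m n ℂ} {U : Matrix m r ℂ} {Z : Matrix n m ℂ} (hA : A * Z * A = A)
    (hU : LinearMap.range U.mulVecLin ≤ LinearMap.range A.mulVecLin) :
    A * Z * U = U := by
  classical
  refine Matrix.ext_of_mulVec_single fun j => ?_
  obtain ⟨y, hy⟩ := hU ⟨Pi.single j 1, rfl⟩
  simp only [Matrix.mulVecLin_apply] at hy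
  rw [← Matrix.mulVec_mulVec, ← hy, Matrix.mulVec_mulVec, hA]

open scoped ComplexOrder in
/-- The identity plus `X * F * Xᴴ` is invertible for an orthogonal projector `F`. -/
lemma isUnit_det_one_add_mul_mul_conjTranspose {n r : Type*} [Fintype n] [DecidableEq n]
    [Fintype r] (X : Matrix n r ℂ) {F : Matrix r r ℂ} (hF : F * F = F) (hFH : Fᴴ = F) :
    IsUnit (1 + X * F * Xᴴ).det := by
  have h : X * F * Xᴴ = (X * F) * (X * F)ᴴ := by
    rw [Matrix.conjTranspose_mul, hFH, ← Matrix.mul_assoc, Matrix.mul_assoc X F F, hF]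
  rw [h, ← Matrix.isUnit_iff_isUnit_det]
  exact (Matrix.PosDef.one.add_posSemidef
    (Matrix.posSemidef_self_mul_conjTranspose (X * F))).isUnit

/-- If `G * M = G` with `M` Hermitian and invertible, then `M⁻¹ * G` is Hermitian iff `G` is. -/
lemma conjTranspose_inv_mul_eq_iff {n : Type*} [Fintype n] [DecidableEq n]
    {M G : Matrix n n ℂ} (hM : Mᴴ = M) (hMu : IsUnit M.det) (hG : G * M = G) :
    (M⁻¹ * G)ᴴ = M⁻¹ * G ↔ Gᴴ = G := by
  have hG' : M * Gᴴ = Gᴴ := by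
    simpa [Matrix.conjTranspose_mul, hM] using congrArg Matrix.conjTranspose hG
  rw [Matrix.conjTranspose_mul, Matrix.conjTranspose_nonsing_inv, hM]
  constructor
  · intro h
    calc Gᴴ = M * (Gᴴ * M⁻¹) * M := by
          rw [Matrix.mul_assoc, Matrix.nonsing_inv_mul_cancel_right _ _ hMu, hG']
      _ = G := by rw [h, Matrix.mul_nonsing_inv_cancel_left _ _ hMu, hG]
  · intro h
    have h1 : M⁻¹ * G = G := by
      rw [h] at hG'
      nth_rw 1 [← hG']
      exact Matrix.nonsing_inv_mul_cancel_left _ _ hMu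
    have h2 : G * M⁻¹ = G := by
      nth_rw 1 [← hG]
      exact Matrix.mul_nonsing_inv_cancel_right _ _ hMu
    rw [h, h1, h2]

theorem stmt_16 {m n r : ℕ}
    (A : Matrix (Fin m) (Fin n) ℂ) (U : Matrix (Fin m) (Fin r) ℂ)
    (V : Matrix (Fin n) (Fin r) ℂ)
    (Adag : Matrix (Fin n) (Fin m) ℂ) (hAdag : IsMP A Adag)
    (S : Matrix (Fin r) (Fin r) ℂ) (hS : S = 1 + Vᴴ * Adag * U)
    (Sdag : Matrix (Fin r) (Fin r) ℂ) (hSdag : IsMP S Sdag)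
    (ES : Matrix (Fin r) (Fin r) ℂ) (hES : ES = 1 - S * Sdag)
    (FS : Matrix (Fin r) (Fin r) ℂ) (hFS : FS = 1 - Sdag * S)
    (hU : LinearMap.range U.mulVecLin ≤ LinearMap.range A.mulVecLin)
    (hV : LinearMap.range V.mulVecLin ≤ LinearMap.range Aᴴ.mulVecLin)
    (Ahat : Matrix (Fin n) (Fin m) ℂ)
    (hAhat : Ahat = (1 + Adag * U * FS * Uᴴ * Adagᴴ)⁻¹ *
      (Adag - Adag * U * Sdag * Vᴴ * Adag) *
      (1 + Adagᴴ * V * ES * Vᴴ * Adag)⁻¹) :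
    (Ahat * (A + U * Vᴴ))ᴴ = Ahat * (A + U * Vᴴ) ↔
      (Adag * U * FS * Vᴴ)ᴴ = Adag * U * FS * Vᴴ := by
  obtain ⟨hA1, hA2, -, hA4⟩ := hAdag
  obtain ⟨hS1, hS2, hS3, hS4⟩ := hSdag
  have hUA : A * Adag * U = U := mul_mul_eq_of_range_le hA1 hU
  have hVA : Vᴴ * Adag * A = Vᴴ := by
    have hA' : Aᴴ * Adagᴴ * Aᴴ = Aᴴ := by
      simpa [Matrix.conjTranspose_mul, Matrix.mul_assoc] using congrArg Matrix.conjTranspose hA1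
    simpa [Matrix.conjTranspose_mul, Matrix.mul_assoc] using
      congrArg Matrix.conjTranspose (mul_mul_eq_of_range_le hA' hV)
  have hE2 : ES * ES = ES := by
    rw [hES, mul_sub, mul_one, sub_mul, one_mul, ← mul_assoc, hS1, sub_self, sub_zero]
  have hF2 : FS * FS = FS := by
    rw [hFS, mul_sub, mul_one, sub_mul, one_mul, ← mul_assoc, hS2, sub_self, sub_zero]
  have hEH : ESᴴ = ES := by rw [hES, Matrix.conjTranspose_sub, hS3, Matrix.conjTranspose_one]
  have hFH : FSᴴ = FS := by rw [hFS, Matrix.conjTranspose_sub, hS4, Matrix.conjTranspose_one]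
  have hES0 : ES * S = 0 := by rw [hES, sub_mul, one_mul, hS1, sub_self]
  have hSF0 : S * FS = 0 := by rw [hFS, mul_sub, mul_one, ← mul_assoc, hS1, sub_self]
  set X := Adag * U with hX
  set W := Vᴴ with hW
  have hS' : S = 1 + W * X := by rw [hS, hX, Matrix.mul_assoc]
  have hQX : Adag * A * X = X := by rw [hX, ← Matrix.mul_assoc, hA2]
  have hMX : X * FS * Uᴴ * Adagᴴ = X * FS * Xᴴ := by
    rw [hX, Matrix.conjTranspose_mul, Matrix.mul_assoc _ Uᴴ]
  have hNX : Adagᴴ * V * ES * W * Adag = (W * Adag)ᴴ * ES * (W * Adag)ᴴᴴ := by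
    rw [Matrix.conjTranspose_conjTranspose, Matrix.conjTranspose_mul, hW,
      Matrix.conjTranspose_conjTranspose, Matrix.mul_assoc _ Vᴴ]
  have hMu : IsUnit (1 + X * FS * Xᴴ).det := isUnit_det_one_add_mul_mul_conjTranspose X hF2 hFH
  have hNu : IsUnit (1 + Adagᴴ * V * ES * W * Adag).det := by
    rw [hNX]
    exact isUnit_det_one_add_mul_mul_conjTranspose _ hE2 hEH
  have hWB : W * Adag * (A + U * W) = S * W := by
    rw [Matrix.mul_add, hVA, hS', Matrix.add_mul, Matrix.one_mul, hX]
    simp only [Matrix.mul_assoc]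
  have hNB : (1 + Adagᴴ * V * ES * W * Adag) * (A + U * W) = A + U * W := by
    have h0 : Adagᴴ * V * ES * W * Adag * (A + U * W) = 0 := by
      rw [Matrix.mul_assoc _ W, Matrix.mul_assoc _ (W * Adag), hWB, ← Matrix.mul_assoc,
        Matrix.mul_assoc _ ES, hES0, Matrix.mul_zero, Matrix.zero_mul]
    rw [Matrix.add_mul, Matrix.one_mul, h0, add_zero]
  have hNiB : (1 + Adagᴴ * V * ES * W * Adag)⁻¹ * (A + U * W) = A + U * W := by
    nth_rw 1 [← hNB]
    exact Matrix.nonsing_inv_mul_cancel_left _ _ hNu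
  have hTB : (Adag - X * Sdag * W * Adag) * (A + U * W) = Adag * A + X * FS * W := by
    rw [Matrix.sub_mul, Matrix.mul_assoc _ W, Matrix.mul_assoc _ (W * Adag), hWB, hFS,
      Matrix.mul_add, ← Matrix.mul_assoc Adag U, ← hX]
    simp only [Matrix.mul_sub, Matrix.sub_mul, Matrix.mul_one, Matrix.mul_assoc]
    abel
  have hWXF : W * X * FS = -FS := by
    rw [hS', Matrix.add_mul, Matrix.one_mul] at hSF0
    exact (neg_eq_of_add_eq_zero_right hSF0).symm
  have hGM : (Adag * A + X * FS * W) * (1 + X * FS * Xᴴ) = Adag * A + X * FS * W := by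
    have h1 : Adag * A * (X * FS * Xᴴ) = X * FS * Xᴴ := by
      rw [← Matrix.mul_assoc, ← Matrix.mul_assoc, hQX]
    have h2 : X * FS * W * (X * FS * Xᴴ) = -(X * FS * Xᴴ) := by
      calc X * FS * W * (X * FS * Xᴴ) = X * FS * (W * X * FS) * Xᴴ := by
            simp only [Matrix.mul_assoc]
        _ = -(X * FS * Xᴴ) := by
            rw [hWXF, Matrix.mul_neg, Matrix.neg_mul, Matrix.mul_assoc X FS FS, hF2]
    rw [Matrix.mul_add, Matrix.mul_one, Matrix.add_mul _ _ (X * FS * Xᴴ), h1, h2,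
      add_neg_cancel, add_zero]
  have hMH : (1 + X * FS * Xᴴ)ᴴ = 1 + X * FS * Xᴴ := by
    simp [Matrix.conjTranspose_mul, hFH, Matrix.mul_assoc]
  have hmain : Ahat * (A + U * W) = (1 + X * FS * Xᴴ)⁻¹ * (Adag * A + X * FS * W) := by
    rw [hAhat, hMX, Matrix.mul_assoc, hNiB, Matrix.mul_assoc, hTB]
  rw [hmain, conjTranspose_inv_mul_eq_iff hMH hMu hGM, Matrix.conjTranspose_add, hA4,
    add_right_inj]
end
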